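/- (Keller–Lieb–Thirring bound, constant-potential regime) Let p > 2, a ∈ [0,1/2], q = p/(p-2), and let φ be a non-negative function in L^q(S¹) with 4a² + ‖φ‖_{L^q}(p-2) ≤ 1. Then for every 2π-periodic continuous ψ with ψ' + iaψ ∈ L²(S¹), ‖ψ' + iaψ‖²_{L²} − ∫_{-π}^{π} φ|ψ|² dσ ≥ (a² − ‖φ‖_{L^q})·‖ψ‖²_{L²}. In other words, λ₁(H_a − φ) ≥ a² − ‖φ‖_{L^q}, and equality is achieved by constant potentials φ. -/

import Mathlib

open Real MeasureTheory

lemma klt_basic {p : ℝ} (hp : 2 < p) {k : ℝ} (hk0 : 0 < k) (hk1 : k < 1) :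
    (1+k)*(1+k)^(p-1) - (1-k)*(1-k)^(p-1) ≤ k*p*((1+k)^(p-1) + (1-k)^(p-1)) := by
  let f : ℝ → ℝ := fun k => k*p*((1+k)^(p-1) + (1-k)^(p-1)) - ((1+k)^p - (1-k)^p)
  have hd : ∀ x ∈ Set.Ico (0:ℝ) 1, HasDerivAt f (x*p*(p-1)*((1+x)^(p-2) - (1-x)^(p-2))) x := by
    intro x hx
    have h1 : (1 + x) ≠ 0 := by linarith [hx.1]
    have h2 : (1 - x) ≠ 0 := by linarith [hx.2]
    have e1 : ∀ r : ℝ, HasDerivAt (fun x : ℝ => (1+x)^r) (r*(1+x)^(r-1)) x := by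
      intro r
      have := ((hasDerivAt_id x).const_add 1).rpow_const (p := r) (Or.inl h1)
      simpa using this
    have e2 : ∀ r : ℝ, HasDerivAt (fun x : ℝ => (1-x)^r) (-(r*(1-x)^(r-1))) x := by
      intro r
      have := ((hasDerivAt_id x).const_sub 1).rpow_const (p := r) (Or.inl h2)
      simpa using this
    have := ((((hasDerivAt_id x).mul_const p).mul ((e1 (p-1)).add (e2 (p-1)))).sub ((e1 p).sub (e2 p)))
    refine this.congr_deriv ?_
    simp only [id]
    rw [show p - 1 - 1 = p - 2 by ring]
    simp
    ring
  have hmono : MonotoneOn f (Set.Ico 0 1) := by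
    apply monotoneOn_of_deriv_nonneg (convex_Ico 0 1)
    · intro x hx; exact (hd x hx).continuousAt.continuousWithinAt
    · intro x hx; rw [interior_Ico] at hx; exact (hd x ⟨hx.1.le, hx.2⟩).differentiableAt.differentiableWithinAt
    · intro x hx
      rw [interior_Ico] at hx
      rw [(hd x ⟨hx.1.le, hx.2⟩).deriv]
      have : (1-x)^(p-2) ≤ (1+x)^(p-2) := Real.rpow_le_rpow (by linarith [hx.2]) (by linarith [hx.1]) (by linarith)
      have := hx.1
      apply mul_nonneg
      · apply mul_nonneg
        · positivity
        · linarith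
      · linarith
  have := hmono (⟨le_rfl, by norm_num⟩ : (0:ℝ) ∈ Set.Ico (0:ℝ) 1) ⟨hk0.le, hk1⟩ hk0.le
  have a1 : (1+k)^p = (1+k)*(1+k)^(p-1) := by
    rw [← Real.rpow_one_add' (by linarith) (by linarith)]; ring_nf
  have a2 : (1-k)^p = (1-k)*(1-k)^(p-1) := by
    rw [← Real.rpow_one_add' (by linarith) (by linarith)]; ring_nf
  simp only [f] at this
  rw [a1, a2] at this
  simp at this
  linarith

lemma klt_basic2 {p : ℝ} (hp : 2 < p) {k : ℝ} (hk0 : 0 < k) (hk1 : k < 1) :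
    2*k*((1+k)^(p-1) + (1-k)^(p-1)) < (1+k)*(1+k)^(p-1) - (1-k)*(1-k)^(p-1) := by
  have a1 : (1+k)^(p-1) = (1+k)*(1+k)^(p-2) := by
    rw [← Real.rpow_one_add' (by linarith) (by linarith)]; ring_nf
  have a2 : (1-k)^(p-1) = (1-k)*(1-k)^(p-2) := by
    rw [← Real.rpow_one_add' (by linarith) (by linarith)]; ring_nf
  have : (1-k)^(p-2) < (1+k)^(p-2) := Real.rpow_lt_rpow (by linarith) (by linarith) (by linarith)
  rw [a1, a2]
  have h : 0 < (1+k)*(1-k) := by apply mul_pos <;> linarith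
  nlinarith [mul_lt_mul_of_pos_left this h]

/-- claim C -/
lemma klt_claim {p : ℝ} (hp : 2 < p) {k : ℝ} (hk0 : 0 < k) (hk1 : k < 1) (N T R : ℝ → ℝ)
    (hN : ∀ k, N k = ((1+k)^p - (1-k)^p)/(2*k*p))
    (hT : ∀ k, T k = ((1+k)^(p-1) + (1-k)^(p-1))/2)
    (hR : ∀ k, R k = (1-k^2)*(p-2*(T k / N k))/(p-2) + p*k^2) :
    0 < N k ∧ 0 < R k ∧ 2 * Real.log (N k) ≤ (p-2) * Real.log (R k) := by
  have a1 : ∀ k : ℝ, 0 < k → k < 1 → (1+k)^p = (1+k)*(1+k)^(p-1) := by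
    intro k _ _
    rw [← Real.rpow_one_add' (by linarith) (by linarith)]; ring_nf
  have a2 : ∀ k : ℝ, 0 < k → k < 1 → (1-k)^p = (1-k)*(1-k)^(p-1) := by
    intro k _ _
    rw [← Real.rpow_one_add' (by linarith) (by linarith)]; ring_nf
  have hTpos : ∀ x : ℝ, 0 < x → x < 1 → 0 < T x := by
    intro x h0 h1
    have : 0 < (1 + x)^(p-1) := Real.rpow_pos_of_pos (by linarith) _
    have : 0 < (1 - x)^(p-1) := Real.rpow_pos_of_pos (by linarith) _
    rw [hT]; positivity
  have hNpos : ∀ x : ℝ, 0 < x → x < 1 → 0 < N x := by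
    intro x h0 h1
    rw [hN]
    apply div_pos
    · have := Real.rpow_lt_rpow (x := 1-x) (y := 1+x) (z := p) (by linarith) (by linarith) (by linarith)
      linarith
    · have : 0 < p := by linarith
      positivity
  have hNT : ∀ x : ℝ, 0 < x → x < 1 → N x ≤ T x := by
    intro x h0 h1
    have := klt_basic hp h0 h1
    rw [hN, hT, a1 x h0 h1, a2 x h0 h1, div_le_iff₀ (by have : 0 < p := by linarith
                                                        positivity)]
    linarith
  have hNT2 : ∀ x : ℝ, 0 < x → x < 1 → 2 * T x < p * N x := by
    intro x h0 h1
    have := klt_basic2 hp h0 h1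
    have hp0 : 0 < p := by linarith
    rw [hN, hT, a1 x h0 h1, a2 x h0 h1]
    rw [show p * (((1 + x) * (1 + x) ^ (p - 1) - (1 - x) * (1 - x) ^ (p - 1)) / (2 * x * p)) = ((1 + x) * (1 + x) ^ (p - 1) - (1 - x) * (1 - x) ^ (p - 1)) / (2 * x) by field_simp]
    rw [lt_div_iff₀ (by positivity)]
    linarith
  have hRpos : ∀ x : ℝ, 0 < x → x < 1 → 0 < R x := by
    intro x h0 h1
    have hn := hNpos x h0 h1
    rw [hR]
    have h3 : 0 < p - 2*(T x / N x) := by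
      have := hNT2 x h0 h1
      rw [sub_pos, ← mul_div_assoc, div_lt_iff₀ hn]
      exact this
    have h4 : 0 < 1 - x^2 := by nlinarith
    have h5 : 0 < p - 2 := by linarith
    have : 0 < p := by linarith
    positivity
  -- derivatives
  have e1 : ∀ x : ℝ, 0 ≤ x → x < 1 →  ∀ r : ℝ, HasDerivAt (fun x : ℝ => (1+x)^r) (r*(1+x)^(r-1)) x := by
    intro x h0 h1 r
    have := ((hasDerivAt_id x).const_add 1).rpow_const (p := r) (Or.inl (by simp; linarith))
    simpa using this
  have e2 : ∀ x : ℝ, 0 ≤ x → x < 1 →  ∀ r : ℝ, HasDerivAt (fun x : ℝ => (1-x)^r) (-(r*(1-x)^(r-1))) x := by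
    intro x h0 h1 r
    have := ((hasDerivAt_id x).const_sub 1).rpow_const (p := r) (Or.inl (by simp; linarith))
    simpa using this
  have hN' : N = fun k => ((1+k)^p - (1-k)^p)/(2*k*p) := funext hN
  have hT' : T = fun k => ((1+k)^(p-1) + (1-k)^(p-1))/2 := funext hT
  have hR' : R = fun k => (1-k^2)*(p-2*(T k / N k))/(p-2) + p*k^2 := funext hR
  have dN : ∀ x : ℝ, 0 < x → x < 1 → HasDerivAt N ((T x - N x)/x) x := by
    intro x h0 h1
    have hp0 : p ≠ 0 := by linarith
    have hx0 : x ≠ 0 := h0.ne'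
    have := ((e1 x h0.le h1 p).sub (e2 x h0.le h1 p)).div
      (((hasDerivAt_id x).const_mul 2).mul_const p) (by simp; exact ⟨hx0, hp0⟩)
    rw [hN']
    refine this.congr_deriv ?_
    simp only [hT, id, Pi.sub_apply]
    field_simp
    ring
  have dT : ∀ x : ℝ, 0 < x → x < 1 → HasDerivAt T ((p-1)*x*(p*N x - 2*T x)/(1-x^2)) x := by
    intro x h0 h1
    have hp0 : p ≠ 0 := by linarith
    have hx0 : x ≠ 0 := h0.ne'
    have hx1 : 1 - x^2 ≠ 0 := by nlinarith
    have := ((e1 x h0.le h1 (p-1)).add (e2 x h0.le h1 (p-1))).div_const 2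
    rw [hT']
    refine this.congr_deriv ?_
    have b1 : (1+x)^(p-1) = (1+x)*(1+x)^(p-1-1) := by
      rw [← Real.rpow_one_add' (by linarith) (by linarith)]; ring_nf
    have b2 : (1-x)^(p-1) = (1-x)*(1-x)^(p-1-1) := by
      rw [← Real.rpow_one_add' (by linarith) (by linarith)]; ring_nf
    simp only [hN]
    rw [a1 x h0 h1, a2 x h0 h1, b1, b2]
    field_simp
    ring
  have dR : ∀ x : ℝ, 0 < x → x < 1 → HasDerivAt R
      ((T x / N x - 1) * (4*p*x^2 + 2*(1-x^2)*(T x / N x)) / ((p-2)*x)) x := by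
    intro x h0 h1
    have hx0 : x ≠ 0 := h0.ne'
    have hn := (hNpos x h0 h1).ne'
    have hx1 : 1 - x^2 ≠ 0 := by nlinarith
    have hp2 : p - 2 ≠ 0 := by linarith
    have d1 := ((dT x h0 h1).div (dN x h0 h1) hn)
    have := ((((hasDerivAt_id x).pow 2).const_sub 1).mul ((d1.const_mul 2).const_sub p)).div_const (p-2)
      |>.add (((hasDerivAt_id x).pow 2).const_mul p)
    rw [hR']
    refine this.congr_deriv ?_
    simp only [id, Pi.pow_apply, Pi.div_apply]
    generalize N x = n at *
    generalize T x = t at *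
    field_simp
    ring
  refine ⟨hNpos k hk0 hk1, hRpos k hk0 hk1, ?_⟩
  set Φ : ℝ → ℝ := fun x => (p-2) * Real.log (R x) - 2 * Real.log (N x) with hΦ
  have dΦ : ∀ x : ℝ, 0 < x → x < 1 → HasDerivAt Φ
      ((p-2) * (((T x / N x - 1) * (4*p*x^2 + 2*(1-x^2)*(T x / N x)) / ((p-2)*x)) / R x)
        - 2 * (((T x - N x)/x) / N x)) x := by
    intro x h0 h1
    exact (((dR x h0 h1).log (hRpos x h0 h1).ne').const_mul (p-2)).sub
      (((dN x h0 h1).log (hNpos x h0 h1).ne').const_mul 2)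
  have hmono : MonotoneOn Φ (Set.Ioo 0 1) := by
    apply monotoneOn_of_deriv_nonneg (convex_Ioo 0 1)
    · intro x hx; exact (dΦ x hx.1 hx.2).continuousAt.continuousWithinAt
    · intro x hx; rw [interior_Ioo] at hx; exact (dΦ x hx.1 hx.2).differentiableAt.differentiableWithinAt
    · intro x hx
      rw [interior_Ioo] at hx
      obtain ⟨h0, h1⟩ := hx
      rw [(dΦ x h0 h1).deriv]
      have hn := hNpos x h0 h1
      have hr := hRpos x h0 h1
      have hp2 : 0 < p - 2 := by linarith
      have hω : 1 ≤ T x / N x := by rw [one_le_div hn]; exact hNT x h0 h1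
      have hq : (T x - N x)/x/N x = (T x / N x - 1)/x := by field_simp
      have hRle : R x ≤ 2*p*x^2 + (1-x^2)*(T x / N x) := by
        rw [hR]
        have h4 : 0 < 1 - x^2 := by nlinarith
        have h6 : (1-x^2)*(p-2*(T x / N x))/(p-2) ≤ (1-x^2)*(T x / N x) := by
          rw [mul_div_assoc]
          apply mul_le_mul_of_nonneg_left _ h4.le
          rw [div_le_iff₀ hp2]
          nlinarith
        nlinarith [mul_nonneg (by linarith : (0:ℝ) ≤ p) (sq_nonneg x)]
      rw [hq]
      generalize T x / N x = ω at *
      rw [show (p-2) * (((ω - 1) * (4*p*x^2 + 2*(1-x^2)*ω) / ((p-2)*x)) / R x) - 2 * ((ω-1)/x)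
        = 2*(ω-1)*((2*p*x^2 + (1-x^2)*ω) - R x) / (x * R x) by field_simp; ring]
      apply div_nonneg
      · apply mul_nonneg <;> linarith
      · positivity
  have lim : Filter.Tendsto Φ (nhdsWithin 0 (Set.Ioi 0)) (nhds 0) := by
    have hp0 : p ≠ 0 := by linarith
    have lN : Filter.Tendsto N (nhdsWithin 0 (Set.Ioi 0)) (nhds 1) := by
      have h := (((e1 0 le_rfl one_pos p).sub (e2 0 le_rfl one_pos p)).tendsto_slope_zero_right).mul_const (1/(2*p))
      have h2 : (p * (1 + (0:ℝ)) ^ (p - 1) - -(p * (1 - (0:ℝ)) ^ (p - 1))) * (1/(2*p)) = 1 := by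
        simp; field_simp; ring
      rw [h2] at h
      refine h.congr' ?_
      filter_upwards [self_mem_nhdsWithin] with x hx
      have hx0 : x ≠ 0 := ne_of_gt hx
      rw [hN]; simp; field_simp
    have lT : Filter.Tendsto T (nhdsWithin 0 (Set.Ioi 0)) (nhds 1) := by
      have h := (((e1 0 le_rfl one_pos (p-1)).add (e2 0 le_rfl one_pos (p-1))).div_const 2).continuousAt.tendsto
      have h2 : ((fun x : ℝ => (1 + x) ^ (p - 1)) + (fun x : ℝ => (1 - x) ^ (p - 1)) : ℝ → ℝ) 0 / 2 = 1 := by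
        simp only [Pi.add_apply, add_zero, sub_zero, Real.one_rpow]; norm_num
      rw [h2] at h
      rw [hT']
      exact Filter.Tendsto.mono_left h nhdsWithin_le_nhds
    have lR : Filter.Tendsto R (nhdsWithin 0 (Set.Ioi 0)) (nhds 1) := by
      have lx : Filter.Tendsto (fun x : ℝ => x) (nhdsWithin 0 (Set.Ioi 0)) (nhds 0) :=
        Filter.Tendsto.mono_left Filter.tendsto_id nhdsWithin_le_nhds
      have := ((((lx.pow 2).const_sub 1).mul (((lT.div lN one_ne_zero).const_mul 2).const_sub p)).div_const (p-2)).add ((lx.pow 2).const_mul p)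
      have hp2 : p - 2 ≠ 0 := by linarith
      have h2 : (1 - (0:ℝ) ^ 2) * (p - 2 * (1 / 1)) / (p - 2) + p * 0 ^ 2 = 1 := by
        rw [show (1 - (0:ℝ) ^ 2) * (p - 2 * (1 / 1)) = p - 2 by ring, div_self hp2]; ring
      rw [h2] at this
      rw [hR']
      exact this
    have := ((lR.log one_ne_zero).const_mul (p-2)).sub ((lN.log one_ne_zero).const_mul 2)
    simpa using this
  have : 0 ≤ Φ k := by
    apply le_of_tendsto lim
    filter_upwards [Ioo_mem_nhdsGT hk0] with x hx
    exact hmono ⟨hx.1, hx.2.trans hk1⟩ ⟨hk0, hk1⟩ hx.2.le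
  simp only [hΦ] at this
  linarith

lemma klt_two_point_aux {p : ℝ} (hp : 2 < p) {k c : ℝ} (hk0 : 0 < k) (hk1 : k < 1) (hc : 0 < c) :
    c^2 - (1-k)^2 - (c^p - (1-k)^p) * (((1+k)^2 - (1-k)^2) / ((1+k)^p - (1-k)^p)) ≤ (p-2)*k^2 := by
  let N : ℝ → ℝ := fun k => ((1+k)^p - (1-k)^p)/(2*k*p)
  let T : ℝ → ℝ := fun k => ((1+k)^(p-1) + (1-k)^(p-1))/2
  let R : ℝ → ℝ := fun k => (1-k^2)*(p-2*(T k / N k))/(p-2) + p*k^2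
  obtain ⟨hN, hR, h⟩ := klt_claim hp hk0 hk1 N T R (fun _ => rfl) (fun _ => rfl) (fun _ => rfl)
  have hp2 : 0 < p - 2 := by linarith
  have hp0 : 0 < p := by linarith
  have hNR : (N k)^(2/(p-2)) ≤ R k := by
    rw [← Real.log_le_log_iff (Real.rpow_pos_of_pos hN _) hR, Real.log_rpow hN, div_mul_eq_mul_div,
      div_le_iff₀ hp2]
    linarith
  -- Young
  have hY : c^2 ≤ (2/p) * (c^p / N k) + (1-2/p) * (N k)^(2/(p-2)) := by
    have h1 : 0 ≤ 1 - 2/p := by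
      rw [sub_nonneg, div_le_one hp0]; exact hp.le
    have := Real.geom_mean_le_arith_mean2_weighted (w₁ := 2/p) (w₂ := 1-2/p) (p₁ := c^p / N k) (p₂ := (N k)^(2/(p-2)))
      (by positivity) h1 (by positivity) (by positivity) (by ring)
    refine le_trans (le_of_eq ?_) this
    rw [Real.div_rpow (by positivity) hN.le, ← Real.rpow_mul hc.le, ← Real.rpow_mul hN.le]
    rw [show 2/(p-2)*(1-2/p) = 2/p by field_simp, show p * (2/p) = (2:ℕ) by push_cast; field_simp, Real.rpow_natCast]
    have : (N k)^(2/p) ≠ 0 := (Real.rpow_pos_of_pos hN _).ne'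
    field_simp
  have a1 : (1+k)^p = (1+k)*(1+k)^(p-1) := by
    rw [← Real.rpow_one_add' (by linarith) (by linarith)]; ring_nf
  have a2 : (1-k)^p = (1-k)*(1-k)^(p-1) := by
    rw [← Real.rpow_one_add' (by linarith) (by linarith)]; ring_nf
  have hlt := Real.rpow_lt_rpow (x := 1-k) (y := 1+k) (z := p) (by linarith) (by linarith) hp0
  have hσ : ((1+k)^2 - (1-k)^2) / ((1+k)^p - (1-k)^p) = (2/p)/N k := by
    simp only [N]
    have : (1+k)^p - (1-k)^p ≠ 0 := by linarith
    field_simp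
    ring
  have hid : (1-k)^2 - (1-k)^p * (((1+k)^2 - (1-k)^2) / ((1+k)^p - (1-k)^p)) = ((p-2)/p) * (R k - p*k^2) := by
    simp only [R, T, N]
    have : (1+k)^p - (1-k)^p ≠ 0 := by linarith
    rw [a1, a2] at *
    generalize (1+k)^(p-1) = X at *
    generalize (1-k)^(p-1) = Y at *
    field_simp
    ring
  have h3 : (1-2/p) * (N k)^(2/(p-2)) ≤ (1-2/p) * R k := by
    apply mul_le_mul_of_nonneg_left hNR
    rw [sub_nonneg, div_le_one hp0]; exact hp.le
  have h4 : c^p * (((1+k)^2 - (1-k)^2) / ((1+k)^p - (1-k)^p)) = (2/p) * (c^p / N k) := by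
    rw [hσ]; ring
  have h5 : ((p-2)/p) * (R k - p*k^2) = (1-2/p) * R k - (p-2)*k^2 := by field_simp
  rw [sub_mul, h4]
  linarith

lemma klt_two_point {p : ℝ} (hp : 2 < p) {a b c : ℝ} (ha : 0 < a) (hab : a < b) (hc : 0 < c) :
    c^2 - a^2 - (c^p - a^p) * ((b^2 - a^2) / (b^p - a^p)) ≤ (p-2)*((b-a)/2)^2 := by
  set M := (a+b)/2 with hM
  have hM0 : 0 < M := by rw [hM]; linarith
  set k := (b-a)/(a+b) with hk
  have hab0 : 0 < a + b := by linarith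
  have h := klt_two_point_aux hp (k := k) (c := c/M) (div_pos (by linarith) hab0)
    (by rw [hk, div_lt_one hab0]; linarith) (by positivity)
  have ea : 1 - k = a / M := by rw [hk, hM]; field_simp; ring
  have eb : 1 + k = b / M := by rw [hk, hM]; field_simp; ring
  have hMp : 0 < M^p := Real.rpow_pos_of_pos hM0 _
  have hlt : a^p < b^p := Real.rpow_lt_rpow ha.le hab (by linarith)
  rw [ea, eb, Real.div_rpow hc.le hM0.le, Real.div_rpow ha.le hM0.le,
    Real.div_rpow (ha.trans hab).le hM0.le] at h
  have e3 : k = ((b-a)/2)/M := by rw [hk, hM]; field_simp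
  rw [e3] at h
  have h2 := mul_le_mul_of_nonneg_left h (sq_nonneg M)
  have hne : b^p - a^p ≠ 0 := by linarith
  have this : b ^ p / M ^ p - a ^ p / M ^ p = (b^p - a^p)/M^p := by ring
  have e4 : c^2 - a^2 - (c^p - a^p) * ((b^2 - a^2) / (b^p - a^p)) = M ^ 2 *
      ((c / M) ^ 2 - (a / M) ^ 2 -
        (c ^ p / M ^ p - a ^ p / M ^ p) * (((b / M) ^ 2 - (a / M) ^ 2) / (b ^ p / M ^ p - a ^ p / M ^ p))) := by
    rw [this]
    field_simp
  have e5 : (p-2)*((b-a)/2)^2 = M ^ 2 * ((p - 2) * ((b - a) / 2 / M) ^ 2) := by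
    rw [div_pow ((b-a)/2) M]; field_simp
  rw [e4, e5]; exact h2

noncomputable def kltV (p a b w : ℝ) : ℝ :=
  (w^2 - a^2 - (w^p - a^p) * ((b^2 - a^2) / (b^p - a^p))) / (p-2)

lemma kltV_left (p a b : ℝ) : kltV p a b a = 0 := by simp [kltV]

lemma kltV_right {p a b : ℝ} (hp : 2 < p) (ha : 0 < a) (hab : a < b) : kltV p a b b = 0 := by
  have hlt : a^p < b^p := Real.rpow_lt_rpow ha.le hab (by linarith)
  have hne : b^p - a^p ≠ 0 := by linarith
  rw [kltV, mul_div_cancel₀ _ hne]; simp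

lemma kltV_le {p a b c : ℝ} (hp : 2 < p) (ha : 0 < a) (hab : a < b) (hc : 0 < c) :
    kltV p a b c ≤ ((b-a)/2)^2 := by
  rw [kltV, div_le_iff₀ (by linarith), mul_comm (((b-a)/2)^2)]
  exact klt_two_point hp ha hab hc

lemma kltV_pos {p a b w : ℝ} (hp : 2 < p) (ha : 0 < a) (haw : a < w) (hwb : w < b) :
    0 < kltV p a b w := by
  have hp0 : 0 < p := by linarith
  have hw : 0 < w := ha.trans haw
  have hb : 0 < b := hw.trans hwb
  have h1 : a^p < w^p := Real.rpow_lt_rpow ha.le haw hp0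
  have h2 : w^p < b^p := Real.rpow_lt_rpow hw.le hwb hp0
  have hs := (Real.strictConcaveOn_rpow (p := 2/p) (by positivity) (by rw [div_lt_one hp0]; exact hp)).slope_anti_adjacent
    (x := a^p) (y := w^p) (z := b^p) (by simp; positivity) (by simp; positivity) h1 h2
  have e : ∀ x : ℝ, 0 < x → (x^p)^(2/p) = x^2 := by
    intro x hx
    rw [← Real.rpow_mul hx.le, show p * (2/p) = (2:ℕ) by push_cast; field_simp, Real.rpow_natCast]
  simp only [e a ha, e w hw, e b hb] at hs
  rw [div_lt_div_iff₀ (by linarith) (by linarith)] at hs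
  rw [kltV]
  apply div_pos _ (by linarith)
  rw [sub_pos, ← mul_div_assoc, div_lt_iff₀ (by linarith)]
  nlinarith

lemma kltV_nonneg {p a b w : ℝ} (hp : 2 < p) (ha : 0 < a) (hab : a < b) (haw : a ≤ w) (hwb : w ≤ b) :
    0 ≤ kltV p a b w := by
  rcases haw.eq_or_lt with rfl | h1
  · rw [kltV_left]
  rcases hwb.eq_or_lt with rfl | h2
  · rw [kltV_right hp ha hab]
  exact (kltV_pos hp ha h1 h2).le

lemma kltV_shift {p a b a' b' : ℝ} (hp : 2 < p) (ha' : 0 < a') (hab' : a' < b')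
    (h : kltV p a b a' = kltV p a b b') (w : ℝ) :
    kltV p a b w = kltV p a b a' + kltV p a' b' w := by
  have hlt : a'^p < b'^p := Real.rpow_lt_rpow ha'.le hab' (by linarith)
  have hne : b'^p - a'^p ≠ 0 := by linarith
  have hp2 : p - 2 ≠ 0 := by linarith
  have hσ : (b'^2 - a'^2) / (b'^p - a'^p) = (b^2 - a^2) / (b^p - a^p) := by
    rw [div_eq_iff hne]
    unfold kltV at h
    generalize (b^2 - a^2) / (b^p - a^p) = σ at *
    field_simp at h
    linarith
  unfold kltV
  rw [hσ]
  generalize (b^2 - a^2) / (b^p - a^p) = σ at *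
  field_simp
  ring

lemma kltV_continuous {p : ℝ} (hp : 2 < p) (a b : ℝ) : Continuous (kltV p a b) := by
  unfold kltV
  have : Continuous fun w : ℝ => w^p := Real.continuous_rpow_const (by linarith)
  fun_prop

lemma klt_half_disc {e : ℝ} (he : 0 < e) : ∫ t in (0:ℝ)..(√e), 2 * √(e - t^2) = π/2 * e := by
  have hr : 0 < √e := Real.sqrt_pos.mpr he
  have hc : Continuous fun t : ℝ => √(e - t^2) := by fun_prop
  have h1 : ∫ t in (-√e)..(√e), √(e - t^2) = π/2*e := by
    have := intervalIntegral.smul_integral_comp_mul_left (a := -1) (b := 1) (fun t => √(e - t^2)) (√e)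
    simp only [mul_neg, mul_one] at this
    rw [← this]
    have h2 : ∀ x : ℝ, √(e - (√e * x)^2) = √e * √(1 - x^2) := by
      intro x
      rw [mul_pow, Real.sq_sqrt he.le, ← Real.sqrt_mul he.le]; ring_nf
    simp only [h2]
    rw [intervalIntegral.integral_const_mul, integral_sqrt_one_sub_sq, smul_eq_mul]
    rw [← mul_assoc, Real.mul_self_sqrt he.le, mul_comm]
  have h3 : ∫ t in (-√e)..0, √(e - t^2) = ∫ t in (0:ℝ)..(√e), √(e - t^2) := by
    have := intervalIntegral.integral_comp_neg (a := 0) (b := √e) (fun t => √(e - t^2))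
    simp only [neg_zero] at this
    rw [← this]
    simp
  have h4 := intervalIntegral.integral_add_adjacent_intervals (hc.intervalIntegrable (μ := volume) (-√e) 0) (hc.intervalIntegrable 0 (√e))
  rw [h3, h1] at h4
  rw [intervalIntegral.integral_const_mul]
  linarith

lemma klt_area {p a b c : ℝ} (hp : 2 < p) (ha : 0 < a) (hac : a < c) (hcb : c < b) :
    π/2 * kltV p a b c ≤ ∫ w in a..b, √(kltV p a b w) := by
  have hab := hac.trans hcb
  set e := kltV p a b c with he
  have he0 : 0 < e := kltV_pos hp ha hac hcb
  have hVc := kltV_continuous hp a b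
  have hsc : Continuous fun w => √(kltV p a b w) := hVc.sqrt
  have key : ∀ t ∈ Set.Ioc 0 (√e), ENNReal.ofReal (2 * √(e - t^2)) ≤
      (volume.restrict (Set.Ioc a b)) {w | t < √(kltV p a b w)} := by
    intro t ht
    have ht2 : t^2 ≤ e := by
      calc t^2 ≤ (√e)^2 := pow_le_pow_left₀ ht.1.le ht.2 2
        _ = e := Real.sq_sqrt he0.le
    obtain ⟨a', ha', hVa⟩ := intermediate_value_Icc hac.le hVc.continuousOn
      (show t^2 ∈ Set.Icc (kltV p a b a) (kltV p a b c) from ⟨by rw [kltV_left]; positivity, ht2⟩)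
    obtain ⟨b', hb', hVb⟩ := intermediate_value_Icc' hcb.le hVc.continuousOn
      (show t^2 ∈ Set.Icc (kltV p a b b) (kltV p a b c) from ⟨by rw [kltV_right hp ha hab]; positivity, ht2⟩)
    have ha'0 : 0 < a' := ha.trans_le ha'.1
    rcases (ha'.2.trans hb'.1).eq_or_lt with hEq | hlt
    · have : c = a' := le_antisymm (hEq ▸ hb'.1) ha'.2
      rw [← this, ← he] at hVa
      simp [← hVa]
    have hsh := kltV_shift hp ha'0 hlt (hVa.trans hVb.symm)
    have h1 : e - t^2 ≤ ((b'-a')/2)^2 := by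
      have := kltV_le hp ha'0 hlt (hac.trans' ha)
      have h2 := hsh c
      rw [hVa] at h2
      linarith
    have h2 : 2 * √(e-t^2) ≤ b' - a' := by
      have : √(e-t^2) ≤ (b'-a')/2 := Real.sqrt_le_iff.mpr ⟨by linarith, h1⟩
      linarith
    calc ENNReal.ofReal (2 * √(e - t^2)) ≤ ENNReal.ofReal (b'-a') := ENNReal.ofReal_le_ofReal h2
      _ = volume (Set.Ioo a' b') := Real.volume_Ioo.symm
      _ ≤ volume ({w | t < √(kltV p a b w)} ∩ Set.Ioc a b) := by
          apply measure_mono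
          intro w hw
          refine ⟨?_, ha'.1.trans_lt hw.1, (hw.2.trans_le hb'.2).le⟩
          apply Real.lt_sqrt_of_sq_lt
          rw [hsh w, hVa]
          linarith [kltV_pos hp ha'0 hw.1 hw.2]
      _ ≤ _ := Measure.le_restrict_apply _ _
  have hlc := lintegral_eq_lintegral_meas_lt (volume.restrict (Set.Ioc a b)) (f := fun w => √(kltV p a b w))
    (Filter.Eventually.of_forall fun w => Real.sqrt_nonneg _) hsc.measurable.aemeasurable
  have hc2 : Continuous fun t : ℝ => 2 * √(e - t^2) := by fun_prop
  have hr : 0 < √e := Real.sqrt_pos.mpr he0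
  rw [← klt_half_disc he0, intervalIntegral.integral_of_le hr.le, intervalIntegral.integral_of_le hab.le]
  have i1 : IntegrableOn (fun t : ℝ => 2 * √(e - t^2)) (Set.Ioc 0 (√e)) :=
    (hc2.intervalIntegrable 0 (√e)).1
  have i2 : IntegrableOn (fun w => √(kltV p a b w)) (Set.Ioc a b) :=
    (hsc.intervalIntegrable a b).1
  rw [← ENNReal.ofReal_le_ofReal_iff (integral_nonneg fun w => Real.sqrt_nonneg _),
    ofReal_integral_eq_lintegral_ofReal i1 (Filter.Eventually.of_forall fun w => by positivity),
    ofReal_integral_eq_lintegral_ofReal i2 (Filter.Eventually.of_forall fun w => Real.sqrt_nonneg _), hlc]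
  refine (setLIntegral_mono' measurableSet_Ioc key).trans ?_
  exact lintegral_mono_set fun x hx => hx.1

lemma klt_area' {p a b c : ℝ} (hp : 2 < p) (ha : 0 < a) (hab : a < b) (hac : a ≤ c) (hcb : c ≤ b) :
    π/2 * kltV p a b c ≤ ∫ w in a..b, √(kltV p a b w) := by
  have h0 : 0 ≤ ∫ w in a..b, √(kltV p a b w) :=
    intervalIntegral.integral_nonneg hab.le fun w _ => Real.sqrt_nonneg _
  rcases hac.eq_or_lt with rfl | h1
  · rw [kltV_left]; simpa using h0
  rcases hcb.eq_or_lt with rfl | h2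
  · rw [kltV_right hp ha hab]; simpa using h0
  exact klt_area hp ha h1 h2

lemma klt_per_deriv {E : Type*} [NormedAddCommGroup E] [NormedSpace ℝ E] {u u' : ℝ → E} {T : ℝ} (hu : ∀ s, HasDerivAt u (u' s) s)
    (hper : Function.Periodic u T) : Function.Periodic u' T := by
  intro s
  have h := (hu (s+T)).comp_add_const s T
  have : (fun x => u (x+T)) = u := funext hper
  rw [this] at h
  exact h.unique (hu s)

lemma klt_shift {f : ℝ → ℝ} (hf : Function.Periodic f (2*π)) (s : ℝ) :
    ∫ x in (-π)..π, f x = ∫ x in s..(s+2*π), f x := by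
  have := hf.intervalIntegral_add_eq (-π) s
  rw [← this]; congr 1; ring

lemma klt_int {f : ℝ → ℝ} (hf : Function.Periodic f (2*π)) (h : IntervalIntegrable f volume (-π) π) (a b : ℝ) :
    IntervalIntegrable f volume a b := by
  apply hf.intervalIntegrable (t := -π) (by positivity)
  convert h using 1; ring

lemma klt_int_of_sq {f : ℝ → ℝ} (hm : Measurable f) {a b : ℝ} (h : IntervalIntegrable (fun s => f s ^2) volume a b)  :
    IntervalIntegrable f volume a b := by
  refine (h.add (intervalIntegrable_const (c := (1:ℝ)))).mono_fun hm.aestronglyMeasurable ?_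
  refine Filter.Eventually.of_forall fun s => ?_
  simp only [Real.norm_eq_abs]
  rw [abs_of_nonneg (by positivity : 0 ≤ f s ^2 + 1)]
  nlinarith [sq_abs (f s), sq_nonneg (|f s| - 1)]

lemma klt_sobolev {p : ℝ} (hp : 2 < p) (u u' : ℝ → ℝ) (hu : ∀ s, HasDerivAt u (u' s) s) (hpos : ∀ s, 0 < u s)
    (hper : Function.Periodic u (2*π)) (hint : IntervalIntegrable (fun s => u' s ^2) volume (-π) π) :
    ((1/(2*π)) * ∫ s in (-π)..π, u s ^ p)^(2/p) - (1/(2*π)) * ∫ s in (-π)..π, u s ^ 2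
      ≤ (p-2) * ((1/(2*π)) * ∫ s in (-π)..π, u' s ^ 2) := by
  have hp0 : 0 < p := by linarith
  have hp2 : 0 < p - 2 := by linarith
  have hcont : Continuous u := continuous_iff_continuousAt.mpr fun s => (hu s).continuousAt
  have hper' : Function.Periodic u' (2*π) := klt_per_deriv hu hper
  have hmeas : Measurable u' := by
    have : u' = deriv u := funext fun s => (hu s).deriv.symm
    rw [this]; exact measurable_deriv u
  have hpi : 0 < 2*π := by positivity
  have hK : IsCompact (Set.range u) := hper.compact_of_continuous hpi.ne' hcont
  obtain ⟨a, ⟨⟨s0, hs0⟩, hmin⟩⟩ := hK.exists_isLeast (Set.range_nonempty u)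
  obtain ⟨b, ⟨⟨s1', hs1'⟩, hmax⟩⟩ := hK.exists_isGreatest (Set.range_nonempty u)
  have hua : ∀ s, a ≤ u s := fun s => hmin ⟨s, rfl⟩
  have hub : ∀ s, u s ≤ b := fun s => hmax ⟨s, rfl⟩
  obtain ⟨s1, hs1m, hs1⟩ := hper.exists_mem_Ico hpi s1' s0
  have hs1 : u s1 = b := by rw [← hs1']; exact hs1.symm
  have ha : 0 < a := hs0 ▸ hpos s0
  have hup : Continuous fun s => u s ^ p := hcont.rpow_const (fun s => Or.inl (hpos s).ne')
  -- average of u^p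
  set A := (1/(2*π)) * ∫ s in (-π)..π, u s ^ p with hA
  have avg_const : ∀ x : ℝ, (1/(2*π)) * ∫ s in (-π)..π, x = x := by
    intro x; rw [intervalIntegral.integral_const, smul_eq_mul]; field_simp; ring
  have hπ : -π ≤ π := by linarith [Real.pi_pos]
  have hAa : a^p ≤ A := by
    rw [← avg_const (a^p), hA]
    apply mul_le_mul_of_nonneg_left _ (by positivity)
    apply intervalIntegral.integral_mono_on hπ (intervalIntegrable_const) (hup.intervalIntegrable _ _)
    intro s _; exact Real.rpow_le_rpow ha.le (hua s) hp0.le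
  have hAb : A ≤ b^p := by
    rw [← avg_const (b^p), hA]
    apply mul_le_mul_of_nonneg_left _ (by positivity)
    apply intervalIntegral.integral_mono_on hπ (hup.intervalIntegrable _ _) (intervalIntegrable_const)
    intro s _; exact Real.rpow_le_rpow (hpos s).le (hub s) hp0.le
  have hA0 : 0 < A := (Real.rpow_pos_of_pos ha p).trans_le hAa
  set c := A^(1/p) with hc
  have hcp : c^p = A := by
    rw [hc, ← Real.rpow_mul hA0.le, one_div_mul_cancel hp0.ne', Real.rpow_one]
  have hc2 : A^(2/p) = c^2 := by
    rw [hc, ← Real.rpow_natCast, ← Real.rpow_mul hA0.le]; congr 1; push_cast; ring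
  have hc0 : 0 < c := Real.rpow_pos_of_pos hA0 _
  have hac : a ≤ c := (Real.rpow_le_rpow_iff ha.le hc0.le hp0).mp (hcp ▸ hAa)
  have hb0 : 0 < b := ha.trans_le ((hua s0).trans (hub s0))
  have hcb : c ≤ b := (Real.rpow_le_rpow_iff hc0.le hb0.le hp0).mp (hcp ▸ hAb)
  have hu'0 : 0 ≤ (1/(2*π)) * ∫ s in (-π)..π, u' s ^ 2 := by
    apply mul_nonneg (by positivity)
    exact intervalIntegral.integral_nonneg hπ fun s _ => sq_nonneg _
  rw [hc2]
  rcases ((hua s0).trans (hub s0)).eq_or_lt with hab | hab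
  · have hue : ∀ s, u s = c := fun s => by linarith [hua s, hub s]
    simp only [hue]
    rw [avg_const]
    nlinarith
  -- main case
  set V := kltV p a b with hV
  have hVc : Continuous V := kltV_continuous hp a b
  have hVs : Continuous fun w => √(V w) := hVc.sqrt
  set P : ℝ → ℝ := fun w => ∫ x in a..w, √(V x) with hP
  have dP : ∀ w, HasDerivAt P (√(V w)) w := fun w => hVs.integral_hasStrictDerivAt a w |>.hasDerivAt
  have dPu : ∀ s, HasDerivAt (fun s => P (u s)) (√(V (u s)) * u' s) s := fun s => (dP (u s)).comp s (hu s)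
  have hint2 : ∀ x y, IntervalIntegrable (fun s => u' s ^ 2) volume x y :=
    klt_int (fun s => by simp only [hper' s]) hint
  have hint1 : ∀ x y, IntervalIntegrable u' volume x y := fun x y => klt_int_of_sq hmeas (hint2 x y)
  have hVuc : Continuous fun s => V (u s) := hVc.comp hcont
  have hintP : ∀ x y, IntervalIntegrable (fun s => √(V (u s)) * u' s) volume x y := fun x y =>
    (hint1 x y).continuousOn_mul hVuc.sqrt.continuousOn
  have hintE : ∀ x y, IntervalIntegrable (fun s => (u' s ^ 2 + V (u s))/2) volume x y := fun x y =>
    ((hint2 x y).add (hVuc.intervalIntegrable x y)).div_const 2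
  have hVn : ∀ s, 0 ≤ V (u s) := fun s => kltV_nonneg hp ha hab (hua s) (hub s)
  have hsq : ∀ s, √(V (u s))^2 = V (u s) := fun s => Real.sq_sqrt (hVn s)
  have f1 : P b - P a ≤ ∫ s in s0..s1, (u' s ^ 2 + V (u s))/2 := by
    rw [← hs0, ← hs1, ← intervalIntegral.integral_eq_sub_of_hasDerivAt (fun s _ => dPu s) (hintP _ _)]
    apply intervalIntegral.integral_mono_on hs1m.1 (hintP _ _) (hintE _ _)
    intro s _
    nlinarith [hsq s, sq_nonneg (√(V (u s)) - u' s)]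
  have f2 : P b - P a ≤ ∫ s in s1..(s0+2*π), (u' s ^ 2 + V (u s))/2 := by
    have e : ∫ s in s1..(s0+2*π), -(√(V (u s)) * u' s) = P b - P a := by
      rw [intervalIntegral.integral_neg, intervalIntegral.integral_eq_sub_of_hasDerivAt (fun s _ => dPu s) (hintP _ _),
        hper s0, hs0, hs1]; ring
    rw [← e]
    apply intervalIntegral.integral_mono_on hs1m.2.le (hintP _ _).neg (hintE _ _)
    intro s _
    simp only [Pi.neg_apply]
    nlinarith [hsq s, sq_nonneg (√(V (u s)) + u' s)]
  have f3 := intervalIntegral.integral_add_adjacent_intervals (hintE s0 s1) (hintE s1 (s0+2*π))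
  have f4 : ∫ s in s0..(s0+2*π), (u' s ^ 2 + V (u s))/2 = ∫ s in (-π)..π, (u' s ^ 2 + V (u s))/2 :=
    (klt_shift (f := fun s => (u' s ^ 2 + V (u s))/2) (fun s => by simp only [hper' s, hper s]) s0).symm
  have f5 : ∫ s in (-π)..π, (u' s ^ 2 + V (u s))/2 = ((∫ s in (-π)..π, u' s ^2) + ∫ s in (-π)..π, V (u s))/2 := by
    rw [intervalIntegral.integral_div, intervalIntegral.integral_add (hint2 _ _) (hVuc.intervalIntegrable _ _)]
  have f6 : P a = 0 := by simp [hP]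
  have f7 : π/2 * V c ≤ P b := klt_area' hp ha hab hac hcb
  have f8 : (1/(2*π)) * ∫ s in (-π)..π, V (u s) = ((1/(2*π)) * (∫ s in (-π)..π, u s ^ 2) - c^2)/(p-2) + V c := by
    have hu2 : IntervalIntegrable (fun s => u s ^2) volume (-π) π := (hcont.pow 2).intervalIntegrable _ _
    have hupi := hup.intervalIntegrable (μ := volume) (-π) π
    simp only [hV, kltV]
    generalize (b^2 - a^2) / (b^p - a^p) = σ
    rw [intervalIntegral.integral_div, intervalIntegral.integral_sub (hu2.sub intervalIntegrable_const)
      ((hupi.sub intervalIntegrable_const).mul_const _), intervalIntegral.integral_sub hu2 intervalIntegrable_const,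
      intervalIntegral.integral_mul_const, intervalIntegral.integral_sub hupi intervalIntegrable_const]
    have g1 := avg_const (a^2)
    have g2 := avg_const (a^p)
    rw [hcp, hA]
    generalize ∫ s in (-π)..π, u s ^ 2 = I2
    generalize ∫ s in (-π)..π, u s ^ p = Ip
    generalize (∫ s in (-π)..π, a ^ 2) = x at *
    generalize (∫ s in (-π)..π, a ^ p) = y at *
    rw [← g1, ← g2]
    field_simp
    ring
  have f9 : V c ≤ (1/(2*π)) * (∫ s in (-π)..π, u' s ^2) + (1/(2*π)) * ∫ s in (-π)..π, V (u s) := by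
    rw [← mul_add, one_div_mul_eq_div, le_div_iff₀ hpi]
    nlinarith
  rw [f8] at f9
  have f10 : (c^2 - (1/(2*π)) * (∫ s in (-π)..π, u s ^ 2))/(p-2) ≤ (1/(2*π)) * (∫ s in (-π)..π, u' s ^2) := by
    have : ((1/(2*π)) * (∫ s in (-π)..π, u s ^ 2) - c^2)/(p-2) = -((c^2 - (1/(2*π)) * (∫ s in (-π)..π, u s ^ 2))/(p-2)) := by ring
    rw [this] at f9
    linarith
  rw [div_le_iff₀ hp2] at f10
  linarith

lemma klt_cint_of_sq {f : ℝ → ℂ} (hm : Measurable f) {a b : ℝ} (h : IntervalIntegrable (fun s => ‖f s‖ ^2) volume a b)  :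
    IntervalIntegrable f volume a b := by
  refine (h.add (intervalIntegrable_const (c := (1:ℝ)))).mono_fun hm.aestronglyMeasurable ?_
  refine Filter.Eventually.of_forall fun s => ?_
  show ‖f s‖ ≤ ‖‖f s‖ ^2 + 1‖
  rw [Real.norm_of_nonneg (by positivity : 0 ≤ ‖f s‖ ^2 + 1)]
  nlinarith [sq_nonneg (‖f s‖ - 1)]

lemma klt_wirtinger (c : ℝ) (g g' : ℝ → ℂ) (hg : ∀ s, HasDerivAt g (g' s) s) (hanti : g (c+2*π) = -g c)
    (hint : IntervalIntegrable (fun s => ‖g' s‖^2) volume c (c+2*π)) :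
    (1/4) * ∫ s in c..(c+2*π), ‖g s‖^2 ≤ ∫ s in c..(c+2*π), ‖g' s‖^2 := by
  have hpi : 0 < 2*π := by positivity
  have hab : c < c + 2*π := by linarith
  have hgc : Continuous g := continuous_iff_continuousAt.mpr fun s => (hg s).continuousAt
  have hmeas : Measurable g' := by
    have : g' = deriv g := funext fun s => (hg s).deriv.symm
    rw [this]; exact measurable_deriv g
  set E : ℝ → ℂ := fun s => Complex.exp (Complex.I * s / 2) with hE
  have dE : ∀ s, HasDerivAt E (E s * (Complex.I/2)) s := by
    intro s
    have h1 : HasDerivAt (fun s : ℝ => Complex.I * (s:ℂ) / 2) (Complex.I / 2) s := by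
      have := ((Complex.ofRealCLM.hasDerivAt (x := s)).const_mul Complex.I).div_const 2
      simpa using this
    exact h1.cexp
  have hEc : Continuous E := continuous_iff_continuousAt.mpr fun s => (dE s).continuousAt
  have nE : ∀ s, ‖E s‖ = 1 := by
    intro s
    simp only [hE]
    rw [show Complex.I * (s:ℂ) / 2 = ((s/2 : ℝ) : ℂ) * Complex.I by push_cast; ring]
    exact Complex.norm_exp_ofReal_mul_I _
  have hE2 : E (c+2*π) = - E c := by
    simp only [hE]
    rw [show Complex.I * ((c+2*π : ℝ):ℂ) / 2 = Complex.I * c / 2 + π * Complex.I by push_cast; ring,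
      Complex.exp_add, Complex.exp_pi_mul_I]; ring
  set G : ℝ → ℂ := fun s => E s * g s with hG
  set K : ℝ → ℂ := fun s => E s * g' s with hK
  have dG : ∀ s, HasDerivAt G (K s + (Complex.I/2) * G s) s := by
    intro s
    refine ((dE s).mul (hg s)).congr_deriv ?_
    simp only [hG, hK]; ring
  have hGc : Continuous G := hEc.mul hgc
  have hKm : Measurable K := hEc.measurable.mul hmeas
  have nG : ∀ s, ‖G s‖ = ‖g s‖ := fun s => by simp only [hG, norm_mul, nE, one_mul]
  have nK : ∀ s, ‖K s‖ = ‖g' s‖ := fun s => by simp only [hK, norm_mul, nE, one_mul]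
  have hKi2 : IntervalIntegrable (fun s => ‖K s‖^2) volume c (c+2*π) := by simpa only [nK] using hint
  have hKi := klt_cint_of_sq hKm hKi2
  have hGi : IntervalIntegrable (fun s => (Complex.I/2) * G s) volume c (c+2*π) :=
    (hGc.const_mul _ |>.intervalIntegrable _ _)
  have hGper : G (c+2*π) - G c = 0 := by simp only [hG, hE2, hanti]; ring
  have coef : ∀ n : ℤ, fourierCoeffOn hab K n = Complex.I * ((n:ℂ) - 1/2) * fourierCoeffOn hab G n := by
    intro n
    have hsum : fourierCoeffOn hab (fun s => K s + (Complex.I/2) * G s) n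
        = fourierCoeffOn hab K n + (Complex.I/2) * fourierCoeffOn hab G n := by
      rw [← fourierCoeffOn.const_mul]
      simp only [fourierCoeffOn_eq_integral]
      have hc : Continuous fun x : ℝ => (fourier (-n) (x : AddCircle (c+2*π-c)) : ℂ) :=
        (fourier (-n)).continuous.comp (AddCircle.continuous_mk' _)
      rw [← smul_add, ← intervalIntegral.integral_add]
      · congr 1
        apply intervalIntegral.integral_congr
        intro x _
        simp only [smul_add]
      · simpa only [smul_eq_mul] using hKi.continuousOn_mul hc.continuousOn
      · simpa only [smul_eq_mul] using hGi.continuousOn_mul hc.continuousOn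
    have hd : fourierCoeffOn hab (fun s => K s + (Complex.I/2) * G s) n = Complex.I * n * fourierCoeffOn hab G n := by
      by_cases hn : n = 0
      · subst hn
        rw [fourierCoeffOn_eq_integral]
        simp only [neg_zero, fourier_zero, one_smul]
        rw [intervalIntegral.integral_eq_sub_of_hasDerivAt (fun s _ => dG s) (hKi.add hGi), hGper]
        simp
      · have := fourierCoeffOn_of_hasDerivAt hab hn (fun s _ => dG s) (hKi.add hGi)
        rw [this, hGper]
        have h1 : (n:ℂ) ≠ 0 := by exact_mod_cast hn
        have h2 : (π:ℂ) ≠ 0 := by exact_mod_cast Real.pi_ne_zero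
        have h3 := Complex.I_ne_zero
        have h4 : Complex.I^2 = -1 := Complex.I_sq
        generalize fourierCoeffOn hab (fun s => K s + (Complex.I/2) * G s) n = Z
        push_cast
        field_simp
        ring
    have := hsum.symm.trans hd
    linear_combination this
  have mG : MemLp G 2 (volume.restrict (Set.Ioc c (c+2*π))) := by
    rw [memLp_two_iff_integrable_sq_norm hGc.aestronglyMeasurable]
    exact ((hGc.norm.pow 2).intervalIntegrable c (c+2*π)).1
  have mK : MemLp K 2 (volume.restrict (Set.Ioc c (c+2*π))) := by
    rw [memLp_two_iff_integrable_sq_norm hKm.aestronglyMeasurable]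
    exact hKi2.1
  have sG := (hasSum_sq_fourierCoeffOn hab mG).mul_left (1/4)
  have sK := hasSum_sq_fourierCoeffOn hab mK
  have hle := hasSum_le (fun n => ?_) sG sK
  · simp only [nG, nK, smul_eq_mul] at hle
    have h5 : 0 < (c+2*π - c)⁻¹ := by rw [add_sub_cancel_left]; positivity
    have h6 : (c+2*π - c)⁻¹ * ((1/4) * ∫ s in c..(c+2*π), ‖g s‖^2) ≤ (c+2*π - c)⁻¹ * ∫ s in c..(c+2*π), ‖g' s‖^2 := by
      linarith
    exact le_of_mul_le_mul_left h6 h5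
  · rw [coef n, norm_mul, norm_mul, Complex.norm_I, one_mul, mul_pow]
    apply mul_le_mul_of_nonneg_right _ (by positivity)
    rw [show ((n:ℂ) - 1/2) = (((n:ℝ) - 1/2 : ℝ) : ℂ) by push_cast; ring, Complex.norm_real, Real.norm_eq_abs, sq_abs]
    have : (0:ℝ) ≤ (n:ℝ) * (n - 1) := by
      have : (0:ℤ) ≤ n * (n-1) := by
        rcases le_or_gt n 0 with h | h
        · exact mul_nonneg_of_nonpos_of_nonpos h (by omega)
        · exact mul_nonneg h.le (by omega)
      exact_mod_cast this
    nlinarith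


/-- zero case, Sobolev by regularisation -/
lemma klt_sobolev_c {p : ℝ} (hp : 2 < p) (a : ℝ) (ψ d : ℝ → ℂ) (hd : ∀ s, HasDerivAt ψ (d s) s)
    (hper : Function.Periodic ψ (2*π))
    (hint : IntervalIntegrable (fun s => ‖d s + Complex.I * (a:ℂ) * ψ s‖^2) volume (-π) π) :
    ((1/(2*π)) * ∫ s in (-π)..π, ‖ψ s‖ ^ p)^(2/p) - (1/(2*π)) * ∫ s in (-π)..π, ‖ψ s‖ ^ 2
      ≤ (p-2) * ((1/(2*π)) * ∫ s in (-π)..π, ‖d s + Complex.I * (a:ℂ) * ψ s‖ ^ 2) := by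
  have hc : Continuous ψ := continuous_iff_continuousAt.mpr fun s => (hd s).continuousAt
  have hmeas : Measurable d := by
    have : d = deriv ψ := funext fun s => (hd s).deriv.symm
    rw [this]; exact measurable_deriv ψ
  have hpi : 0 < π := Real.pi_pos
  refine le_of_forall_pos_le_add fun e he => ?_
  set N : ℝ → ℝ := fun s => (ψ s).re^2 + (ψ s).im^2 + e with hN
  have hNpos : ∀ s, 0 < N s := fun s => by simp only [hN]; positivity
  have hre : ∀ s, HasDerivAt (fun s => (ψ s).re) (d s).re s := fun s =>
    (Complex.reCLM.hasFDerivAt.comp_hasDerivAt s (hd s))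
  have him : ∀ s, HasDerivAt (fun s => (ψ s).im) (d s).im s := fun s =>
    (Complex.imCLM.hasFDerivAt.comp_hasDerivAt s (hd s))
  have dN : ∀ s, HasDerivAt N (2*((ψ s).re * (d s).re + (ψ s).im * (d s).im)) s := by
    intro s
    refine ((((hre s).pow 2).add ((him s).pow 2)).add_const e).congr_deriv ?_
    push_cast; ring
  set u : ℝ → ℝ := fun s => √(N s) with hu
  set u' : ℝ → ℝ := fun s => ((ψ s).re * (d s).re + (ψ s).im * (d s).im) / √(N s) with hu'
  have du : ∀ s, HasDerivAt u (u' s) s := by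
    intro s
    refine ((dN s).sqrt (hNpos s).ne').congr_deriv ?_
    have := Real.sqrt_pos.mpr (hNpos s)
    simp only [hu']
    field_simp
  have hupos : ∀ s, 0 < u s := fun s => Real.sqrt_pos.mpr (hNpos s)
  have huc : Continuous u := continuous_iff_continuousAt.mpr fun s => (du s).continuousAt
  have huper : Function.Periodic u (2*π) := fun s => by simp only [hu, hN, hper s]
  have nsq : ∀ s, ‖ψ s‖^2 = (ψ s).re^2 + (ψ s).im^2 := fun s => by
    rw [Complex.sq_norm, Complex.normSq_apply]; ring
  have usq : ∀ s, u s ^2 = ‖ψ s‖^2 + e := fun s => by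
    rw [nsq]; exact Real.sq_sqrt (hNpos s).le
  have hu'le : ∀ s, u' s ^2 ≤ ‖d s + Complex.I * (a:ℂ) * ψ s‖^2 := by
    intro s
    simp only [hu']
    rw [div_pow, Real.sq_sqrt (hNpos s).le, div_le_iff₀ (hNpos s), Complex.sq_norm, Complex.normSq_apply]
    simp only [hN, Complex.add_re, Complex.mul_re, Complex.add_im, Complex.mul_im, Complex.I_re, Complex.I_im, Complex.ofReal_re, Complex.ofReal_im]
    generalize (ψ s).re = x
    generalize (ψ s).im = y
    generalize (d s).re = z
    generalize (d s).im = t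
    have : 0 ≤ e * ((z - a*y)^2 + (t + a*x)^2) := by positivity
    nlinarith [sq_nonneg (x*(t+a*x) - y*(z-a*y))]
  have hu'm : Measurable u' := by
    have : u' = deriv u := funext fun s => (du s).deriv.symm
    rw [this]; exact measurable_deriv u
  have hi : IntervalIntegrable (fun s => u' s^2) volume (-π) π := by
    refine hint.mono_fun (hu'm.pow_const 2).aestronglyMeasurable (Filter.Eventually.of_forall fun s => ?_)
    show ‖u' s ^2‖ ≤ ‖‖d s + Complex.I * (a:ℂ) * ψ s‖^2‖
    rw [Real.norm_of_nonneg (by positivity), Real.norm_of_nonneg (by positivity)]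
    exact hu'le s
  have key := klt_sobolev hp u u' du hupos huper hi
  have hle : (-π) ≤ π := by linarith
  have k1 : ∫ s in (-π)..π, u' s ^2 ≤ ∫ s in (-π)..π, ‖d s + Complex.I * (a:ℂ) * ψ s‖^2 :=
    intervalIntegral.integral_mono_on hle hi hint fun s _ => hu'le s
  have k2 : ∫ s in (-π)..π, u s ^2 = (∫ s in (-π)..π, ‖ψ s‖^2) + (2*π) * e := by
    simp only [usq]
    have hc2 : Continuous fun s => ‖ψ s‖^2 := hc.norm.pow 2
    rw [intervalIntegral.integral_add (hc2.intervalIntegrable _ _) intervalIntegrable_const]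
    rw [intervalIntegral.integral_const, smul_eq_mul]; ring
  have hcp : Continuous fun s => ‖ψ s‖^p := hc.norm.rpow_const fun s => Or.inr (by linarith)
  have k3 : ∫ s in (-π)..π, ‖ψ s‖^p ≤ ∫ s in (-π)..π, u s ^ p := by
    refine intervalIntegral.integral_mono_on hle (hcp.intervalIntegrable _ _)
      ((huc.rpow_const fun s => Or.inr (by linarith)).intervalIntegrable _ _) fun s _ => ?_
    refine Real.rpow_le_rpow (norm_nonneg _) ?_ (by linarith)
    refine le_of_sq_le_sq ?_ (hupos s).le
    rw [usq]; linarith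
  have k3' : 0 ≤ ∫ s in (-π)..π, ‖ψ s‖^p := intervalIntegral.integral_nonneg hle fun s _ => by positivity
  have k4 : ((1/(2*π)) * ∫ s in (-π)..π, ‖ψ s‖ ^ p)^(2/p) ≤ ((1/(2*π)) * ∫ s in (-π)..π, u s ^ p)^(2/p) :=
    Real.rpow_le_rpow (by positivity) (mul_le_mul_of_nonneg_left k3 (by positivity)) (by positivity)
  have k5 : (p-2) * ((1/(2*π)) * ∫ s in (-π)..π, u' s ^ 2) ≤ (p-2) * ((1/(2*π)) * ∫ s in (-π)..π, ‖d s + Complex.I * (a:ℂ) * ψ s‖ ^ 2) := by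
    apply mul_le_mul_of_nonneg_left _ (by linarith)
    exact mul_le_mul_of_nonneg_left k1 (by positivity)
  have k6 : (1/(2*π)) * ∫ s in (-π)..π, u s ^2 = (1/(2*π)) * (∫ s in (-π)..π, ‖ψ s‖^2) + e := by
    rw [k2]; field_simp
  linarith

lemma klt_zero_case (a : ℝ) (ψ d : ℝ → ℂ) (hd : ∀ s, HasDerivAt ψ (d s) s)
    (hper : Function.Periodic ψ (2*π)) {s0 : ℝ} (h0 : ψ s0 = 0)
    (hint : IntervalIntegrable (fun s => ‖d s + Complex.I * (a:ℂ) * ψ s‖^2) volume (-π) π) :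
    (1/4) * ∫ s in (-π)..π, ‖ψ s‖ ^ 2 ≤ ∫ s in (-π)..π, ‖d s + Complex.I * (a:ℂ) * ψ s‖ ^ 2 := by
  have hdper := klt_per_deriv hd hper
  set w : ℝ → ℂ := fun s => d s + Complex.I * (a:ℂ) * ψ s with hw
  have wper : Function.Periodic (fun s => ‖w s‖^2) (2*π) := fun s => by simp only [hw, hdper s, hper s]
  have pper : Function.Periodic (fun s => ‖ψ s‖^2) (2*π) := fun s => by simp only [hper s]
  set E : ℝ → ℂ := fun s => Complex.exp (Complex.I * a * s) with hE
  have dE : ∀ s, HasDerivAt E (E s * (Complex.I * a)) s := by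
    intro s
    have h1 : HasDerivAt (fun s : ℝ => Complex.I * a * (s:ℂ)) (Complex.I * a) s := by
      have := ((Complex.ofRealCLM.hasDerivAt (x := s)).const_mul (Complex.I * a))
      simpa using this
    exact h1.cexp
  have nE : ∀ s, ‖E s‖ = 1 := by
    intro s
    simp only [hE]
    rw [show Complex.I * a * (s:ℂ) = ((a*s : ℝ) : ℂ) * Complex.I by push_cast; ring]
    exact Complex.norm_exp_ofReal_mul_I _
  have key := klt_wirtinger s0 (fun s => E s * ψ s) (fun s => E s * w s)
    (fun s => ((dE s).mul (hd s)).congr_deriv (by simp only [hw]; ring))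
    (by simp only [hper s0, h0]; simp)
    (by simp only [norm_mul, nE, one_mul]; exact klt_int wper hint _ _)
  simp only [norm_mul, nE, one_mul] at key
  rw [klt_shift wper s0, klt_shift pper s0]
  exact key


lemma klt_winding (ψ d : ℝ → ℂ) (hd : ∀ s, HasDerivAt ψ (d s) s)
    (hper : Function.Periodic ψ (2*π)) (hne : ∀ s, ψ s ≠ 0)
    (hi : ∀ a b, IntervalIntegrable (fun s => d s / ψ s) volume a b) :
    ∃ k : ℤ, ∫ s in (-π)..π, d s / ψ s = k * (2 * π * Complex.I) := by
  set Z : ℝ → ℂ := fun y => Complex.exp (- ∫ s in (-π)..y, d s / ψ s) * ψ y with hZ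
  have hc : Continuous ψ := continuous_iff_continuousAt.mpr fun s => (hd s).continuousAt
  have hloc : IsLocallyConstant Z := by
    rw [IsLocallyConstant.iff_eventually_eq]
    intro y0
    have hcq : Continuous fun y => ψ y / ψ y0 := hc.div_const _
    have hmem : (fun y => ψ y / ψ y0) ⁻¹' Complex.slitPlane ∈ nhds y0 := by
      apply hcq.continuousAt.preimage_mem_nhds
      apply Complex.isOpen_slitPlane.mem_nhds
      rw [div_self (hne y0)]; exact Complex.one_mem_slitPlane
    obtain ⟨ε, hε, hball⟩ := Metric.mem_nhds_iff.mp hmem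
    filter_upwards [Metric.ball_mem_nhds y0 hε] with y hy
    have hsub : ∀ x ∈ Set.uIcc y0 y, ψ x / ψ y0 ∈ Complex.slitPlane := by
      intro x hx
      apply hball
      have := (convex_ball y0 ε).ordConnected.uIcc_subset (Metric.mem_ball_self hε) hy
      exact this hx
    have hint : ∫ s in y0..y, d s / ψ s = Complex.log (ψ y / ψ y0) - Complex.log (ψ y0 / ψ y0) := by
      apply intervalIntegral.integral_eq_sub_of_hasDerivAt (f := fun y => Complex.log (ψ y / ψ y0)) _ (hi _ _)
      intro x hx
      refine (((hd x).div_const (ψ y0)).clog_real (hsub x hx)).congr_deriv ?_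
      have h1 := hne x
      have h2 := hne y0
      field_simp
    rw [div_self (hne y0), Complex.log_one, sub_zero] at hint
    have hadd := intervalIntegral.integral_add_adjacent_intervals (hi (-π) y0) (hi y0 y)
    simp only [hZ]
    rw [← hadd, hint, neg_add, Complex.exp_add, Complex.exp_neg (Complex.log _), Complex.exp_log (div_ne_zero (hne y) (hne y0))]
    have h1 := hne y
    have h2 := hne y0
    field_simp
  have h1 := hloc.apply_eq_of_preconnectedSpace (-π) π
  have h2 : ψ π = ψ (-π) := by rw [← hper (-π)]; congr 1; ring
  simp only [hZ, intervalIntegral.integral_same, neg_zero, Complex.exp_zero, one_mul, h2] at h1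
  have h3 : Complex.exp (- ∫ s in (-π)..π, d s / ψ s) = 1 := by
    have := hne (-π)
    exact mul_right_cancel₀ this (by rw [one_mul]; exact h1.symm)
  obtain ⟨n, hn⟩ := Complex.exp_eq_one_iff.mp h3
  refine ⟨-n, ?_⟩
  push_cast
  linear_combination -hn

lemma klt_nonzero_case {a : ℝ} (ha0 : 0 ≤ a) (ha1 : a ≤ 1/2) (ψ d : ℝ → ℂ) (hd : ∀ s, HasDerivAt ψ (d s) s)
    (hper : Function.Periodic ψ (2*π)) (hne : ∀ s, ψ s ≠ 0)
    (hint : IntervalIntegrable (fun s => ‖d s + Complex.I * (a:ℂ) * ψ s‖^2) volume (-π) π) :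
    ∃ u' : ℝ → ℝ, (∀ s, HasDerivAt (fun s => ‖ψ s‖) (u' s) s) ∧
      IntervalIntegrable (fun s => u' s ^2) volume (-π) π ∧
      (1 - 4*a^2) * (∫ s in (-π)..π, u' s ^2) + a^2 * (∫ s in (-π)..π, ‖ψ s‖ ^ 2)
       ≤ ∫ s in (-π)..π, ‖d s + Complex.I * (a:ℂ) * ψ s‖ ^ 2 := by
  have hc : Continuous ψ := continuous_iff_continuousAt.mpr fun s => (hd s).continuousAt
  have hmeas : Measurable d := by
    have : d = deriv ψ := funext fun s => (hd s).deriv.symm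
    rw [this]; exact measurable_deriv ψ
  have hpi : 0 < π := Real.pi_pos
  have hle : (-π) ≤ π := by linarith
  have hdper := klt_per_deriv hd hper
  have hre : ∀ s, HasDerivAt (fun s => (ψ s).re) (d s).re s := fun s =>
    (Complex.reCLM.hasFDerivAt.comp_hasDerivAt s (hd s))
  have him : ∀ s, HasDerivAt (fun s => (ψ s).im) (d s).im s := fun s =>
    (Complex.imCLM.hasFDerivAt.comp_hasDerivAt s (hd s))
  set u : ℝ → ℝ := fun s => ‖ψ s‖ with hu
  have upos : ∀ s, 0 < u s := fun s => norm_pos_iff.mpr (hne s)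
  have une : ∀ s, u s ≠ 0 := fun s => (upos s).ne'
  have usq : ∀ s, u s ^2 = (ψ s).re^2 + (ψ s).im^2 := fun s => by
    simp only [hu]; rw [Complex.sq_norm, Complex.normSq_apply]; ring
  have huc : Continuous u := hc.norm
  set u' : ℝ → ℝ := fun s => ((ψ s).re * (d s).re + (ψ s).im * (d s).im) / u s with hu'
  set v : ℝ → ℝ := fun s => ((ψ s).re * ((d s).im + a * (ψ s).re) - (ψ s).im * ((d s).re - a * (ψ s).im)) / u s with hv
  have du : ∀ s, HasDerivAt u (u' s) s := by
    intro s
    have e1 : u = fun s => √((ψ s).re^2 + (ψ s).im^2) := by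
      funext s; rw [← usq, Real.sqrt_sq (upos s).le]
    have e2 : HasDerivAt (fun s => (ψ s).re^2 + (ψ s).im^2) (2*((ψ s).re * (d s).re + (ψ s).im * (d s).im)) s := by
      refine (((hre s).pow 2).add ((him s).pow 2)).congr_deriv ?_
      push_cast; ring
    have e3 := e2.sqrt (by rw [← usq]; exact pow_ne_zero _ (une s))
    rw [← e1, ← usq, Real.sqrt_sq (upos s).le] at e3
    refine e3.congr_deriv ?_
    have := une s
    simp only [hu']
    field_simp
  have wsq : ∀ s, ‖d s + Complex.I * (a:ℂ) * ψ s‖^2 = u' s^2 + v s^2 := by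
    intro s
    have h1 := une s
    simp only [hu', hv]
    rw [div_pow, div_pow, ← add_div, eq_div_iff (pow_ne_zero _ h1), usq, Complex.sq_norm, Complex.normSq_apply]
    simp only [Complex.add_re, Complex.mul_re, Complex.add_im, Complex.mul_im, Complex.I_re, Complex.I_im, Complex.ofReal_re, Complex.ofReal_im]
    ring
  have vu : ∀ s, v s / u s = (d s / ψ s).im + a := by
    intro s
    have h1 := une s
    have h2 : (ψ s).re^2 + (ψ s).im^2 ≠ 0 := by rw [← usq]; exact pow_ne_zero _ h1
    simp only [hv]
    rw [div_div, ← sq, usq, Complex.div_im, Complex.normSq_apply, ← sq, ← sq]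
    field_simp
    ring
  have hu'm : Measurable u' := by
    have : u' = deriv u := funext fun s => (du s).deriv.symm
    rw [this]; exact measurable_deriv u
  have hvm : Measurable v := by
    have m1 : Measurable fun s => (d s).re := Complex.measurable_re.comp hmeas
    have m2 : Measurable fun s => (d s).im := Complex.measurable_im.comp hmeas
    have m3 : Measurable fun s => (ψ s).re := Complex.measurable_re.comp hc.measurable
    have m4 : Measurable fun s => (ψ s).im := Complex.measurable_im.comp hc.measurable
    have m5 := huc.measurable
    exact ((m3.mul (m2.add (m3.const_mul a))).sub (m4.mul (m1.sub (m4.const_mul a)))).div m5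
  have hi : IntervalIntegrable (fun s => u' s^2) volume (-π) π := by
    refine hint.mono_fun (hu'm.pow_const 2).aestronglyMeasurable (Filter.Eventually.of_forall fun s => ?_)
    show ‖u' s ^2‖ ≤ ‖‖d s + Complex.I * (a:ℂ) * ψ s‖^2‖
    rw [Real.norm_of_nonneg (by positivity), Real.norm_of_nonneg (by positivity), wsq]
    linarith [sq_nonneg (v s)]
  have hiv : IntervalIntegrable (fun s => v s^2) volume (-π) π := by
    refine hint.mono_fun (hvm.pow_const 2).aestronglyMeasurable (Filter.Eventually.of_forall fun s => ?_)
    show ‖v s ^2‖ ≤ ‖‖d s + Complex.I * (a:ℂ) * ψ s‖^2‖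
    rw [Real.norm_of_nonneg (by positivity), Real.norm_of_nonneg (by positivity), wsq]
    linarith [sq_nonneg (u' s)]
  have hiv1 := klt_int_of_sq hvm hiv
  have huic : Continuous fun s => (u s)⁻¹ := huc.inv₀ une
  have hui2 : Continuous fun s => ((u s)⁻¹)^2 := huic.pow 2
  have hivu : IntervalIntegrable (fun s => v s / u s) volume (-π) π := by
    simp only [div_eq_mul_inv]
    exact hiv1.mul_continuousOn huic.continuousOn
  -- integrability of d/ψ
  have hwm : Measurable fun s => d s + Complex.I * (a:ℂ) * ψ s := hmeas.add (hc.measurable.const_mul _)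
  have hwi := klt_cint_of_sq hwm hint
  have hwper : Function.Periodic (fun s => ‖d s + Complex.I * (a:ℂ) * ψ s‖^2) (2*π) := fun s => by
    simp only [hper s, hdper s]
  have hdi : ∀ x y, IntervalIntegrable d volume x y := by
    intro x y
    have h1 := klt_cint_of_sq hwm (klt_int hwper hint x y)
    have h2 : IntervalIntegrable (fun s => Complex.I * (a:ℂ) * ψ s) volume x y := by
      apply Continuous.intervalIntegrable; fun_prop
    have h3 := h1.sub h2
    refine h3.congr ?_
    intro s _
    simp
  have hdp : ∀ x y, IntervalIntegrable (fun s => d s / ψ s) volume x y := by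
    intro x y
    simp only [div_eq_mul_inv]
    exact (hdi x y).mul_continuousOn (hc.inv₀ hne).continuousOn
  obtain ⟨k, hk⟩ := klt_winding ψ d hd hper hne hdp
  have him2 : ∫ s in (-π)..π, (d s / ψ s).im = 2 * π * k := by
    have := Complex.imCLM.intervalIntegral_comp_comm (hdp (-π) π)
    simp only [Complex.imCLM_apply] at this
    rw [this, hk]
    simp; ring
  set I : ℝ := ∫ s in (-π)..π, v s / u s with hI
  have hIv : I = 2 * π * (a + k) := by
    rw [hI]
    simp only [vu]
    rw [intervalIntegral.integral_add _ intervalIntegrable_const, him2, intervalIntegral.integral_const, smul_eq_mul]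
    · ring
    · have := (hivu.sub (intervalIntegrable_const (c := a)))
      refine this.congr ?_
      intro s _
      simp [vu]
  have hI2 : 4 * π^2 * a^2 ≤ I^2 := by
    rw [hIv]
    have h1 : (0:ℝ) ≤ k * (2*a + k) := by
      rcases lt_trichotomy k 0 with h | h | h
      · have : (k:ℝ) ≤ -1 := by exact_mod_cast (by omega : k ≤ -1)
        exact mul_nonneg_of_nonpos_of_nonpos (by linarith) (by linarith)
      · simp [h]
      · have : (1:ℝ) ≤ k := by exact_mod_cast (by omega : 1 ≤ k)
        apply mul_nonneg <;> linarith
    have : 0 ≤ 4 * π^2 * (k * (2*a + k)) := by positivity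
    nlinarith
  set J : ℝ := ∫ s in (-π)..π, ((u s)⁻¹)^2 with hJ
  have hJpos : 0 < J := by
    apply intervalIntegral.intervalIntegral_pos_of_pos (hui2.intervalIntegrable _ _) _ (by linarith)
    intro s
    have := upos s
    positivity
  have hV : I^2 / J ≤ ∫ s in (-π)..π, v s^2 := by
    have h1 : 0 ≤ ∫ s in (-π)..π, (v s - (I/J) * (u s)⁻¹)^2 :=
      intervalIntegral.integral_nonneg hle fun s _ => sq_nonneg _
    have h2 : ∫ s in (-π)..π, (v s - (I/J) * (u s)⁻¹)^2 = ((∫ s in (-π)..π, v s^2) - (2*(I/J)) * I) + (I/J)^2 * J := by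
      rw [hI, hJ, ← intervalIntegral.integral_const_mul, ← intervalIntegral.integral_const_mul,
        ← intervalIntegral.integral_sub hiv (hivu.const_mul _),
        ← intervalIntegral.integral_add (hiv.sub (hivu.const_mul _)) ((hui2.intervalIntegrable _ _).const_mul _)]
      apply intervalIntegral.integral_congr
      intro s _
      show (v s - (I/J) * (u s)⁻¹)^2 = v s ^2 - 2*(I/J) * (v s / u s) + (I/J)^2 * ((u s)⁻¹)^2
      rw [div_eq_mul_inv (v s)]; ring
    rw [h2] at h1
    have h3 : (2*(I/J)) * I = 2 * (I^2/J) := by ring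
    have h4 : (I/J)^2 * J = I^2/J := by field_simp
    linarith
  have hW : (1/4) * (∫ s in (-π)..π, u s ^2) ≤ (∫ s in (-π)..π, u' s^2) + π^2 / J := by
    set E : ℝ → ℂ := fun s => Complex.exp ((((π/J) * ∫ x in (-π)..s, ((u x)⁻¹)^2 : ℝ) : ℂ) * Complex.I) with hE
    have dE : ∀ s, HasDerivAt E (E s * ((((π/J) * ((u s)⁻¹)^2 : ℝ) : ℂ) * Complex.I)) s := by
      intro s
      have h1 := ((hui2.integral_hasStrictDerivAt (-π) s).hasDerivAt.const_mul (π/J)).ofReal_comp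
      exact (h1.mul_const Complex.I).cexp
    have nE : ∀ s, ‖E s‖ = 1 := fun s => Complex.norm_exp_ofReal_mul_I _
    have dg : ∀ s, HasDerivAt (fun s => E s * (u s : ℂ)) (E s * ((u' s : ℂ) + ((π/J * (u s)⁻¹ : ℝ) : ℂ) * Complex.I)) s := by
      intro s
      refine ((dE s).mul (du s).ofReal_comp).congr_deriv ?_
      have : (u s : ℂ) ≠ 0 := by exact_mod_cast une s
      push_cast
      field_simp
      ring
    have ng : ∀ s, ‖E s * ((u' s : ℂ) + ((π/J * (u s)⁻¹ : ℝ) : ℂ) * Complex.I)‖^2 = u' s^2 + (π/J)^2 * ((u s)⁻¹)^2 := by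
      intro s
      rw [norm_mul, nE, one_mul, Complex.sq_norm, Complex.normSq_add_mul_I]; ring
    have hpp : -π + 2*π = π := by ring
    have upi : u π = u (-π) := by simp only [hu]; rw [← hper (-π), hpp]
    have key := klt_wirtinger (-π) _ _ dg (by
        rw [hpp, upi]
        simp only [hE, intervalIntegral.integral_same]
        rw [← hJ, div_mul_cancel₀ _ hJpos.ne', Complex.exp_pi_mul_I]; simp)
      (by simp only [ng]; rw [hpp]; exact hi.add ((hui2.intervalIntegrable _ _).const_mul _))
    simp only [ng] at key
    rw [hpp, intervalIntegral.integral_add hi ((hui2.intervalIntegrable _ _).const_mul _), intervalIntegral.integral_const_mul, ← hJ] at key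
    have h4 : (π/J)^2 * J = π^2/J := by field_simp
    rw [h4] at key
    have h5 : ∀ s, ‖E s * (u s : ℂ)‖ = u s := fun s => by
      rw [norm_mul, nE, one_mul, Complex.norm_real, Real.norm_of_nonneg (upos s).le]
    simpa only [h5] using key
  refine ⟨u', du, hi, ?_⟩
  simp only [wsq]
  rw [intervalIntegral.integral_add hi hiv]
  have h6 : 4 * a^2 * (π^2/J) ≤ I^2/J := by
    rw [← mul_div_assoc]
    apply div_le_div_of_nonneg_right _ hJpos.le
    linarith
  have h7 := mul_le_mul_of_nonneg_left hW (by positivity : 0 ≤ 4*a^2)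
  show (1 - 4*a^2) * (∫ s in (-π)..π, u' s ^2) + a^2 * (∫ s in (-π)..π, u s ^ 2) ≤ _
  nlinarith


lemma klt_interp {p a M : ℝ} (hp : 2 < p) (ha0 : 0 ≤ a) (ha1 : a ≤ 1/2) (hM : 0 ≤ M)
    (hcond : 4 * a^2 + M * (p-2) ≤ 1) (ψ d : ℝ → ℂ) (hd : ∀ s, HasDerivAt ψ (d s) s)
    (hper : Function.Periodic ψ (2*π))
    (hint : IntervalIntegrable (fun s => ‖d s + Complex.I * (a:ℂ) * ψ s‖^2) volume (-π) π) :
    M * (((1/(2*π)) * ∫ s in (-π)..π, ‖ψ s‖ ^ p)^(2/p) - (1/(2*π)) * ∫ s in (-π)..π, ‖ψ s‖ ^ 2)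
      + a^2 * ((1/(2*π)) * ∫ s in (-π)..π, ‖ψ s‖ ^ 2)
      ≤ (1/(2*π)) * ∫ s in (-π)..π, ‖d s + Complex.I * (a:ℂ) * ψ s‖ ^ 2 := by
  have hpi : 0 < π := Real.pi_pos
  have hpi2 : 0 ≤ 1/(2*π) := by positivity
  have hle : (-π) ≤ π := by linarith
  by_cases h : ∃ s0, ψ s0 = 0
  · obtain ⟨s0, h0⟩ := h
    have k1 := klt_zero_case a ψ d hd hper h0 hint
    have k2 := klt_sobolev_c hp a ψ d hd hper hint
    have k3 : 0 ≤ ∫ s in (-π)..π, ‖d s + Complex.I * (a:ℂ) * ψ s‖ ^ 2 :=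
      intervalIntegral.integral_nonneg hle fun s _ => by positivity
    have k1' := mul_le_mul_of_nonneg_left k1 hpi2
    have k3' := mul_nonneg hpi2 k3
    have k4 := mul_le_mul_of_nonneg_left k2 hM
    have k5 := mul_le_mul_of_nonneg_right hcond k3'
    have k6 := mul_le_mul_of_nonneg_left k1' (by positivity : 0 ≤ 4*a^2)
    nlinarith
  · push Not at h
    obtain ⟨u', du, hi, key⟩ := klt_nonzero_case ha0 ha1 ψ d hd hper h hint
    have k2 := klt_sobolev hp (fun s => ‖ψ s‖) u' du (fun s => norm_pos_iff.mpr (h s)) (fun s => by simp only [hper s]) hi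
    have k3 : 0 ≤ ∫ s in (-π)..π, u' s ^ 2 :=
      intervalIntegral.integral_nonneg hle fun s _ => by positivity
    have k1' := mul_le_mul_of_nonneg_left key hpi2
    have k3' := mul_nonneg hpi2 k3
    have k4 := mul_le_mul_of_nonneg_left k2 hM
    have k5 := mul_le_mul_of_nonneg_right hcond k3'
    nlinarith

lemma klt_holder {p q : ℝ} (hp : 2 < p) (hq : q = p / (p - 2)) (φ : ℝ → ℝ) (hφmeas : Measurable φ)
    (hφ0 : ∀ s, 0 ≤ φ s) (hφLq : IntervalIntegrable (fun s => φ s ^ q) volume (-π) π)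
    (ψ : ℝ → ℂ) (hc : Continuous ψ) :
    (1/(2*π)) * ∫ s in (-π)..π, φ s * ‖ψ s‖^2 ≤
      ((1/(2*π)) * ∫ s in (-π)..π, φ s ^ q)^(1/q) * ((1/(2*π)) * ∫ s in (-π)..π, ‖ψ s‖ ^ p)^(2/p) := by
  have hpi : 0 < π := Real.pi_pos
  have hle : (-π) ≤ π := by linarith
  have hp2 : 0 < p - 2 := by linarith
  have hq0 : 0 < q := by rw [hq]; positivity
  have hsum : 1/q + 2/p = 1 := by
    rw [hq]; field_simp; ring
  have hconj : q.HolderConjugate (p/2) := by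
    rw [Real.holderConjugate_iff]
    refine ⟨?_, ?_⟩
    · rw [hq, lt_div_iff₀ hp2]; linarith
    · rw [inv_div, ← one_div]; exact hsum
  have m1 : MemLp φ (ENNReal.ofReal q) (volume.restrict (Set.Ioc (-π) π)) := by
    rw [← integrable_norm_rpow_iff hφmeas.aestronglyMeasurable (by simpa using hq0) ENNReal.ofReal_ne_top]
    rw [ENNReal.toReal_ofReal hq0.le]
    simp only [Real.norm_of_nonneg (hφ0 _)]
    exact hφLq.1
  have hc2 : Continuous fun s => ‖ψ s‖^2 := hc.norm.pow 2
  have m2 : MemLp (fun s => ‖ψ s‖^2) (ENNReal.ofReal (p/2)) (volume.restrict (Set.Ioc (-π) π)) := by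
    rw [← integrable_norm_rpow_iff hc2.aestronglyMeasurable (by simp; linarith) ENNReal.ofReal_ne_top]
    rw [ENNReal.toReal_ofReal (by linarith)]
    exact ((hc2.norm.rpow_const fun s => Or.inr (by linarith)).intervalIntegrable (-π) π).1
  have key := integral_mul_le_Lp_mul_Lq_of_nonneg hconj (Filter.Eventually.of_forall hφ0)
    (Filter.Eventually.of_forall fun s => by positivity) m1 m2
  have e : ∀ s, (‖ψ s‖^2)^(p/2) = ‖ψ s‖^p := fun s => by
    rw [← Real.rpow_natCast, ← Real.rpow_mul (norm_nonneg _)]; congr 1; push_cast; ring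
  simp only [e, one_div_div] at key
  simp only [← intervalIntegral.integral_of_le hle] at key
  have n1 : 0 ≤ ∫ s in (-π)..π, φ s ^ q :=
    intervalIntegral.integral_nonneg hle fun s _ => Real.rpow_nonneg (hφ0 s) _
  have n2 : 0 ≤ ∫ s in (-π)..π, ‖ψ s‖ ^ p :=
    intervalIntegral.integral_nonneg hle fun s _ => by positivity
  rw [Real.mul_rpow (by positivity) n1, Real.mul_rpow (by positivity) n2]
  have h1 : (1/(2*π))^(1/q) * (1/(2*π))^(2/p) = 1/(2*π) := by
    rw [← Real.rpow_add (by positivity), hsum, Real.rpow_one]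
  calc _ ≤ 1/(2*π) * _ := mul_le_mul_of_nonneg_left key (by positivity)
    _ = ((1/(2*π))^(1/q) * (1/(2*π))^(2/p)) * _ := by rw [h1]
    _ = _ := by ring


/-- Keller–Lieb–Thirring bound, constant-potential regime:
if `p > 2`, `a ∈ [0,1/2]`, `q = p/(p-2)`, `φ ≥ 0` is in `L^q(S¹)` and
`4a² + ‖φ‖_{L^q}(p-2) ≤ 1`, then for every admissible `ψ`,
`‖ψ' + iaψ‖²_{L²} - ∫ φ |ψ|² dσ ≥ (a² - ‖φ‖_{L^q}) ‖ψ‖²_{L²}`, i.e.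
`λ₁(H_a - φ) ≥ a² - ‖φ‖_{L^q}`; moreover, for constant potentials `φ`
equality is achieved by some admissible `ψ`. -/
theorem keller_lieb_thirring (p a q : ℝ) (hp : 2 < p) (ha0 : 0 ≤ a) (ha1 : a ≤ 1 / 2)
    (hq : q = p / (p - 2)) (φ : ℝ → ℝ) (hφmeas : Measurable φ)
    (hφ0 : ∀ s, 0 ≤ φ s) (hφper : Function.Periodic φ (2 * π))
    (hφLq : IntervalIntegrable (fun s => φ s ^ q) volume (-π) π)
    (hcond : 4 * a ^ 2
      + ((1 / (2 * π)) * ∫ s in (-π)..π, φ s ^ q) ^ (1 / q) * (p - 2) ≤ 1) :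
    (∀ ψ : ℝ → ℂ, Continuous ψ → Function.Periodic ψ (2 * π) → Differentiable ℝ ψ →
      IntervalIntegrable (fun s => ‖deriv ψ s + Complex.I * (a : ℂ) * ψ s‖ ^ 2)
        volume (-π) π →
      (a ^ 2 - ((1 / (2 * π)) * ∫ s in (-π)..π, φ s ^ q) ^ (1 / q))
          * ((1 / (2 * π)) * ∫ s in (-π)..π, ‖ψ s‖ ^ 2)
        ≤ (1 / (2 * π)) * (∫ s in (-π)..π, ‖deriv ψ s + Complex.I * (a : ℂ) * ψ s‖ ^ 2)
          - (1 / (2 * π)) * ∫ s in (-π)..π, φ s * ‖ψ s‖ ^ 2)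
    ∧ ((∃ c : ℝ, ∀ s, φ s = c) →
      ∃ ψ : ℝ → ℂ, Continuous ψ ∧ Function.Periodic ψ (2 * π) ∧ Differentiable ℝ ψ ∧
        ψ ≠ 0 ∧
        (a ^ 2 - ((1 / (2 * π)) * ∫ s in (-π)..π, φ s ^ q) ^ (1 / q))
            * ((1 / (2 * π)) * ∫ s in (-π)..π, ‖ψ s‖ ^ 2)
          = (1 / (2 * π)) * (∫ s in (-π)..π, ‖deriv ψ s + Complex.I * (a : ℂ) * ψ s‖ ^ 2)
            - (1 / (2 * π)) * ∫ s in (-π)..π, φ s * ‖ψ s‖ ^ 2) := by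
  have hpi : 0 < π := Real.pi_pos
  have hle : (-π) ≤ π := by linarith
  have n1 : 0 ≤ ∫ s in (-π)..π, φ s ^ q :=
    intervalIntegral.integral_nonneg hle fun s _ => Real.rpow_nonneg (hφ0 s) _
  have hM : 0 ≤ ((1 / (2 * π)) * ∫ s in (-π)..π, φ s ^ q) ^ (1 / q) := by positivity
  refine ⟨?_, ?_⟩
  · intro ψ hc hper hdiff hint
    have k1 := klt_interp hp ha0 ha1 hM hcond ψ (deriv ψ) (fun s => (hdiff s).hasDerivAt) hper hint
    have k2 := klt_holder hp hq φ hφmeas hφ0 hφLq ψ hc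
    linarith
  · rintro ⟨c, hcc⟩
    have hc0 : 0 ≤ c := by rw [← hcc 0]; exact hφ0 0
    have hq0 : q ≠ 0 := by
      rw [hq]; exact div_ne_zero (by linarith) (by linarith)
    refine ⟨fun _ => 1, continuous_const, fun _ => rfl, differentiable_const _, ?_, ?_⟩
    · intro h
      exact one_ne_zero (congrFun h 0)
    · have e1 : ((1 / (2 * π)) * ∫ s in (-π)..π, φ s ^ q) ^ (1 / q) = c := by
        simp only [hcc]
        rw [intervalIntegral.integral_const, smul_eq_mul,
          show 1 / (2 * π) * ((π - -π) * c ^ q) = c ^ q by field_simp; ring,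
          ← Real.rpow_mul hc0, mul_one_div_cancel hq0, Real.rpow_one]
      rw [e1]
      simp only [hcc, deriv_const, zero_add, mul_one, norm_mul, Complex.norm_I, one_mul, norm_one, one_pow,
        Complex.norm_real, Real.norm_eq_abs, sq_abs, intervalIntegral.integral_const, smul_eq_mul]
      field_simp
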